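/- Let A and B be unital rings with 2 invertible, and φ: A → B a map with φ(0) = 0, φ(I) = I, such that the entrywise extension φ₂ to 2×2 matrices sends involutions to involutions. Then φ(-T) = -φ(T) for all T ∈ A. -/

import Mathlib

theorem stmt_16 (A B : Type*) [Ring A] [Ring B] [Invertible (2 : A)] [Invertible (2 : B)]
    (φ : A → B) (h0 : φ 0 = 0) (h1 : φ 1 = 1)
    (hinv : ∀ M : Matrix (Fin 2) (Fin 2) A, M * M = 1 → (M.map φ) * (M.map φ) = 1) :
    ∀ T : A, φ (-T) = -φ T := by
  intro T
  have hM : (!![T, 1; 1 - T * T, -T] : Matrix (Fin 2) (Fin 2) A) * !![T, 1; 1 - T * T, -T] = 1 := by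
    rw [Matrix.mul_fin_two, Matrix.one_fin_two]
    congr 1
    ext i j
    fin_cases i <;> fin_cases j <;> simp <;> noncomm_ring
  have h := congrFun (congrFun (hinv _ hM) 0) 1
  simp [Matrix.mul_apply, Fin.sum_univ_two, h1] at h
  exact eq_neg_of_add_eq_zero_right h
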